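/- Let p ∈ (1, ∞) and let k be a positive integer. For every sequence (a_n) in ℓ^p(ℤ) and every n ∈ ℤ, (𝓚a_n)^k = Σ_{S ∈ 𝕊_k} 𝓚[𝓗^S a]_n + Σ_{j=1}^{k−1} Σ_{S ∈ 𝕊_j} 𝓘[(a · 𝓗^S a)]_n · (𝓚a_n)^{k−j−1}, where (a · 𝓗^S a) denotes the sequence with entries a_n · 𝓗^S a_n. -/

import Mathlib

open scoped BigOperators
open MeasureTheory

noncomputable section

/-- The ℓ^p norm of a doubly infinite complex sequence. -/
def lpNorm (p : ℝ) (a : ℤ → ℂ) : ℝ := (∑' n : ℤ, ‖a n‖ ^ p) ^ (1 / p)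

/-- Membership in ℓ^p(ℤ). -/
def MemLpZ (p : ℝ) (a : ℤ → ℂ) : Prop := Summable fun n : ℤ => ‖a n‖ ^ p

/-- The operator norm of an operator on ℓ^p(ℤ): the least admissible constant. -/
def opNormOn (p : ℝ) (T : (ℤ → ℂ) → ℤ → ℂ) : ℝ :=
  sInf {C : ℝ | 0 ≤ C ∧ ∀ a : ℤ → ℂ, MemLpZ p a → lpNorm p (T a) ≤ C * lpNorm p a}

/-- The Riesz–Titchmarsh operator: 𝓡 a_n = (1/π) Σ_{m ∈ ℤ} a_{n-m}/(m + 1/2). -/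
def RT (a : ℤ → ℂ) (n : ℤ) : ℂ :=
  (1 / (Real.pi : ℂ)) * ∑' m : ℤ, a (n - m) / ((m : ℂ) + 1 / 2)

/-- The Kak–Hilbert transform: 𝓚 a_n = (2/π) Σ_{m odd} a_{n-m}/m. -/
def KT (a : ℤ → ℂ) (n : ℤ) : ℂ :=
  (2 / (Real.pi : ℂ)) * ∑' m : {m : ℤ // Odd m}, a (n - (m : ℤ)) / ((m : ℤ) : ℂ)

/-- The discrete Hilbert transform: 𝓗₀ a_n = (1/π) Σ_{m ≠ 0} a_{n-m}/m. -/
def H0T (a : ℤ → ℂ) (n : ℤ) : ℂ :=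
  (1 / (Real.pi : ℂ)) * ∑' m : {m : ℤ // m ≠ 0}, a (n - (m : ℤ)) / ((m : ℤ) : ℂ)

/-- The operator 𝓗: 𝓗 a_n = (2/π) Σ_{m even, m ≠ 0} a_{n-m}/m. -/
def HT (a : ℤ → ℂ) (n : ℤ) : ℂ :=
  (2 / (Real.pi : ℂ)) *
    ∑' m : {m : ℤ // Even (m : ℤ) ∧ (m : ℤ) ≠ 0}, a (n - (m : ℤ)) / ((m : ℤ) : ℂ)

/-- The operator 𝓘: 𝓘 a_n = (4/π²) Σ_{m odd} a_{n-m}/m². -/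
def IT (a : ℤ → ℂ) (n : ℤ) : ℂ :=
  (4 / (Real.pi : ℂ) ^ 2) * ∑' m : {m : ℤ // Odd m}, a (n - (m : ℤ)) / ((m : ℤ) : ℂ) ^ 2

/-- p* = max(p, p/(p-1)). -/
def pstar (p : ℝ) : ℝ := max p (p / (p - 1))

/-- C_p = cot(π/(2 p*)). -/
def Cconst (p : ℝ) : ℝ := Real.cot (Real.pi / (2 * pstar p))


/-- Frames: every integer is a frame; every finite set of frames is a frame
(represented here as a list of frames). -/
inductive Frame : Type
  | int : ℤ → Frame
  | set : List Frame → Frame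

namespace Frame

/-- The size of a frame: the number of integers appearing in it. -/
def size : Frame → ℕ
  | .int _ => 1
  | .set l => (l.attach.map (fun x => size x.1)).sum
  decreasing_by simp only [Frame.set.sizeOf_spec]; have := List.sizeOf_lt_of_mem x.2; omega

/-- The building 𝓗^{{F}} a with frame {F}. -/
def build (a : ℤ → ℂ) : Frame → ℤ → ℂ
  | .int _ => a
  | .set l => HT (fun n => (l.attach.map (fun x => build a x.1 n)).prod)
  decreasing_by simp only [Frame.set.sizeOf_spec]; have := List.sizeOf_lt_of_mem x.2; omega

/-- The building 𝓗^F a for a set frame F: the product Π_{f ∈ F} 𝓗^{{f}} a. -/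
def buildProd (a : ℤ → ℂ) (F : Frame) : ℤ → ℂ :=
  match F with
  | .int _ => a
  | .set l => fun n => (l.map (fun f => build a f n)).prod

/-- The building norm C_p^{{F}}. -/
def frameNorm (p : ℝ) : Frame → ℝ
  | .int _ => 1
  | .set l => Cconst (p / (Frame.set l).size) * (l.attach.map (fun x => frameNorm p x.1)).prod
  decreasing_by simp only [Frame.set.sizeOf_spec]; have := List.sizeOf_lt_of_mem x.2; omega

/-- The building norm C_p^F for a set frame F: the product Π_{f ∈ F} C_p^{{f}}. -/
def setNorm (p : ℝ) (F : Frame) : ℝ :=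
  match F with
  | .int _ => 1
  | .set l => (l.map (frameNorm p)).prod

/-- Adjoin a new element to a set frame. -/
def addElem (F g : Frame) : Frame :=
  match F with
  | .int m => Frame.set [g, .int m]
  | .set l => Frame.set (g :: l)

end Frame

/-- The list of skeletons of size k: 𝕊₁ = {{1}},
𝕊_{k+1} = {{S, k+1} : S ∈ 𝕊_k} ∪ {S ∪ {{k+1}} : S ∈ 𝕊_k}. -/
def skeletons : ℕ → List Frame
  | 0 => []
  | 1 => [Frame.set [Frame.int 1]]
  | (k + 2) =>
      (skeletons (k + 1)).map (fun S => Frame.set [S, Frame.int ((k : ℤ) + 2)]) ++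
      (skeletons (k + 1)).map (fun S => S.addElem (Frame.set [Frame.int ((k : ℤ) + 2)]))


open scoped ENNReal

/-- The weight `(1 + |m|) ^ (-s)` on the integers. -/
def decayWeight (s : ℝ) (m : ℤ) : ℝ≥0∞ := ENNReal.ofReal ((1 + |(m : ℝ)|) ^ (-s))

lemma one_add_abs_pos (m : ℤ) : 0 < 1 + |(m : ℝ)| := by positivity

lemma decayWeight_zero (s : ℝ) : decayWeight s 0 = 1 := by simp [decayWeight]

lemma decayWeight_anti {s t : ℝ} (h : s ≤ t) (m : ℤ) : decayWeight t m ≤ decayWeight s m := by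
  refine ENNReal.ofReal_le_ofReal (Real.rpow_le_rpow_of_exponent_le ?_ (by linarith))
  linarith [abs_nonneg (m : ℝ)]

lemma tsum_decayWeight_ne_top {s : ℝ} (hs : 1 < s) : ∑' m, decayWeight s m ≠ ∞ := by
  have h : Summable fun m : ℤ => (1 + |(m : ℝ)|) ^ (-s) := by
    refine Summable.of_nonneg_of_le (fun m => by positivity) (fun m => ?_)
      ((Real.summable_abs_int_rpow hs).add
        (summable_of_hasFiniteSupport (f := (Pi.single 0 1 : ℤ → ℝ))
          ((Set.finite_singleton 0).subset Pi.support_single_subset)))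
    rcases eq_or_ne m 0 with rfl | hm
    · simpa using Real.rpow_nonneg le_rfl _
    · have hm' : 0 < |(m : ℝ)| := by positivity
      simpa [hm] using Real.rpow_le_rpow_of_nonpos hm' (by linarith) (by linarith : -s ≤ 0)
  exact h.tsum_ofReal_ne_top

lemma rpow_mul_rpow_le_add {x y s t : ℝ} (hx : 1 ≤ x) (hy : 1 ≤ y) (hs : 0 ≤ s) (ht : 0 ≤ t) :
    x ^ (-s) * y ^ (-t) ≤ x ^ (-(s + t)) + y ^ (-(s + t)) := by
  have hx0 : 0 < x := by linarith
  have hy0 : 0 < y := by linarith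
  rcases le_total x y with h | h
  · calc x ^ (-s) * y ^ (-t) ≤ x ^ (-s) * x ^ (-t) := by
          exact mul_le_mul_of_nonneg_left (Real.rpow_le_rpow_of_nonpos hx0 h (neg_nonpos.2 ht))
            (by positivity)
      _ = x ^ (-(s + t)) := by rw [← Real.rpow_add hx0]; ring_nf
      _ ≤ _ := le_add_of_nonneg_right (by positivity)
  · calc x ^ (-s) * y ^ (-t) ≤ y ^ (-s) * y ^ (-t) := by
          exact mul_le_mul_of_nonneg_right (Real.rpow_le_rpow_of_nonpos hy0 h (neg_nonpos.2 hs))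
            (by positivity)
      _ = y ^ (-(s + t)) := by rw [← Real.rpow_add hy0]; ring_nf
      _ ≤ _ := le_add_of_nonneg_left (by positivity)

lemma inv_mul_rpow_le {x y z α β : ℝ} (hx : 1 ≤ x) (hy : 1 ≤ y) (hz : 0 < z)
    (hzxy : z ≤ x + y) (hα : 0 ≤ α) (hα1 : α ≤ 1) (hαβ : α ≤ β) :
    x ^ (-(1 : ℝ)) * y ^ (-β) ≤
      2 * (z ^ (-α) * (x ^ (-(1 + (β - α))) + y ^ (-(1 + (β - α))))) := by
  have hx0 : 0 < x := by linarith
  have hy0 : 0 < y := by linarith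
  have h1 : z ^ α ≤ x ^ α + y ^ α :=
    (Real.rpow_le_rpow hz.le hzxy hα).trans (Real.rpow_add_le_add_rpow hx0.le hy0.le hα hα1)
  have h2 := rpow_mul_rpow_le_add hx hy (s := 1 - α) (t := β) (by linarith) (by linarith)
  have h3 := rpow_mul_rpow_le_add hx hy (s := 1) (t := β - α) (by linarith) (by linarith)
  have e1 : x ^ α * x ^ (-(1 : ℝ)) = x ^ (-(1 - α)) := by
    rw [← Real.rpow_add hx0]; ring_nf
  have e2 : y ^ α * y ^ (-β) = y ^ (-(β - α)) := by
    rw [← Real.rpow_add hy0]; ring_nf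
  have e3 : 1 - α + β = 1 + (β - α) := by ring
  rw [e3] at h2
  have h4 : z ^ α * (x ^ (-(1 : ℝ)) * y ^ (-β)) ≤
      2 * (x ^ (-(1 + (β - α))) + y ^ (-(1 + (β - α)))) := by
    calc z ^ α * (x ^ (-(1 : ℝ)) * y ^ (-β))
        ≤ (x ^ α + y ^ α) * (x ^ (-(1 : ℝ)) * y ^ (-β)) := by gcongr
      _ = (x ^ α * x ^ (-(1 : ℝ))) * y ^ (-β) + x ^ (-(1 : ℝ)) * (y ^ α * y ^ (-β)) := by ring
      _ ≤ _ := by rw [e1, e2]; linarith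
  calc x ^ (-(1 : ℝ)) * y ^ (-β) = z ^ (-α) * (z ^ α * (x ^ (-(1 : ℝ)) * y ^ (-β))) := by
        rw [← mul_assoc, ← Real.rpow_add hz]; simp
    _ ≤ z ^ (-α) * (2 * (x ^ (-(1 + (β - α))) + y ^ (-(1 + (β - α))))) := by gcongr
    _ = _ := by ring

lemma decayWeight_one_mul_le {α β : ℝ} (hα : 0 ≤ α) (hα1 : α ≤ 1) (hαβ : α ≤ β) (m n : ℤ) :
    decayWeight 1 m * decayWeight β n ≤
      2 * (decayWeight α (m + n) *
        (decayWeight (1 + (β - α)) m + decayWeight (1 + (β - α)) n)) := by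
  have h := inv_mul_rpow_le (x := 1 + |(m : ℝ)|) (y := 1 + |(n : ℝ)|)
    (z := 1 + |((m + n : ℤ) : ℝ)|) (by simp) (by simp) (one_add_abs_pos _)
    (by push_cast; linarith [abs_add_le (m : ℝ) n]) hα hα1 hαβ
  have h' := ENNReal.ofReal_le_ofReal h
  unfold decayWeight
  rw [ENNReal.ofReal_mul (by positivity), ENNReal.ofReal_mul (by positivity),
    ENNReal.ofReal_mul (by positivity), ENNReal.ofReal_add (by positivity) (by positivity)] at h'
  simpa using h'

lemma tsum_decayWeight_sub_mul_le {α β : ℝ} (hα : 0 ≤ α) (hα1 : α ≤ 1) (hαβ : α ≤ β) (m n : ℤ) :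
    ∑' j, decayWeight 1 (j - m) * decayWeight β (n - j) ≤
      4 * (∑' j, decayWeight (1 + (β - α)) j) * decayWeight α (n - m) := by
  calc ∑' j, decayWeight 1 (j - m) * decayWeight β (n - j)
      ≤ ∑' j, 2 * (decayWeight α (n - m) *
          (decayWeight (1 + (β - α)) (j - m) + decayWeight (1 + (β - α)) (n - j))) := by
        refine ENNReal.tsum_le_tsum fun j => ?_
        have h := decayWeight_one_mul_le hα hα1 hαβ (j - m) (n - j)
        rwa [show j - m + (n - j) = n - m by ring] at h
    _ = _ := by
        have h₁ := (Equiv.subRight m).tsum_eq (decayWeight (1 + (β - α)))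
        have h₂ := (Equiv.subLeft n).tsum_eq (decayWeight (1 + (β - α)))
        simp only [Equiv.subRight_apply, Equiv.subLeft_apply] at h₁ h₂
        rw [ENNReal.tsum_mul_left, ENNReal.tsum_mul_left, ENNReal.tsum_add, h₁, h₂]
        ring

/-- Sequences whose convolution with a weight `(1 + |m|) ^ (-α)`, for some `0 ≤ α < 1`,
is bounded. -/
def ConvBounded (f : ℤ → ℂ) : Prop :=
  ∃ α : ℝ, 0 ≤ α ∧ α < 1 ∧ ∃ C : ℝ≥0∞, C ≠ ∞ ∧ ∀ n, ∑' j, ‖f j‖ₑ * decayWeight α (n - j) ≤ C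

/-- The convolution of `|f|` with `1 / (1 + |m|)`. -/
def absConv (f : ℤ → ℂ) (n : ℤ) : ℝ≥0∞ := ∑' j, ‖f j‖ₑ * decayWeight 1 (n - j)

lemma ConvBounded.absConv_le {f : ℤ → ℂ} (hf : ConvBounded f) :
    ∃ C : ℝ≥0∞, C ≠ ∞ ∧ ∀ n, absConv f n ≤ C := by
  obtain ⟨α, -, hα1, C, hC, h⟩ := hf
  refine ⟨C, hC, fun n => (ENNReal.tsum_le_tsum fun j => ?_).trans (h n)⟩
  gcongr
  exact decayWeight_anti hα1.le _

lemma ConvBounded.enorm_le {f : ℤ → ℂ} (hf : ConvBounded f) :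
    ∃ C : ℝ≥0∞, C ≠ ∞ ∧ ∀ n, ‖f n‖ₑ ≤ C := by
  obtain ⟨α, -, -, C, hC, h⟩ := hf
  refine ⟨C, hC, fun n => le_trans ?_ (h n)⟩
  simpa [decayWeight_zero] using ENNReal.le_tsum (f := fun j => ‖f j‖ₑ * decayWeight α (n - j)) n

lemma ConvBounded.mul {f g : ℤ → ℂ} (hf : ConvBounded f) (hg : ConvBounded g) :
    ConvBounded fun n => f n * g n := by
  obtain ⟨D, hD, hfD⟩ := hf.enorm_le
  obtain ⟨α, hα, hα1, C, hC, h⟩ := hg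
  refine ⟨α, hα, hα1, D * C, ENNReal.mul_ne_top hD hC, fun n => ?_⟩
  calc ∑' j, ‖f j * g j‖ₑ * decayWeight α (n - j)
      ≤ ∑' j, D * (‖g j‖ₑ * decayWeight α (n - j)) := by
        refine ENNReal.tsum_le_tsum fun j => ?_
        rw [enorm_mul, mul_assoc]
        gcongr
        exact hfD j
    _ ≤ D * C := by
        rw [ENNReal.tsum_mul_left]
        gcongr
        exact h n

lemma ConvBounded.of_enorm_le_absConv {f g : ℤ → ℂ} (hf : ConvBounded f) {D : ℝ≥0∞} (hD : D ≠ ∞)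
    (hg : ∀ n, ‖g n‖ₑ ≤ D * absConv f n) : ConvBounded g := by
  obtain ⟨α, hα, hα1, C, hC, h⟩ := hf
  obtain ⟨β, hαβ, hβ1⟩ := exists_between hα1
  set A := 4 * ∑' j, decayWeight (1 + (β - α)) j with hA
  have hA' : A ≠ ∞ := ENNReal.mul_ne_top (by simp) (tsum_decayWeight_ne_top (by linarith))
  refine ⟨β, hα.trans hαβ.le, hβ1, D * (A * C),
    ENNReal.mul_ne_top hD (ENNReal.mul_ne_top hA' hC), fun n => ?_⟩
  calc ∑' j, ‖g j‖ₑ * decayWeight β (n - j)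
      ≤ ∑' j, D * ∑' i, ‖f i‖ₑ * (decayWeight 1 (j - i) * decayWeight β (n - j)) := by
        refine ENNReal.tsum_le_tsum fun j => ?_
        simp_rw [← mul_assoc (‖f _‖ₑ)]
        rw [ENNReal.tsum_mul_right, ← mul_assoc]
        gcongr
        exact hg j
    _ = D * ∑' i, ‖f i‖ₑ * ∑' j, decayWeight 1 (j - i) * decayWeight β (n - j) := by
        rw [ENNReal.tsum_mul_left, ENNReal.tsum_comm]
        simp_rw [ENNReal.tsum_mul_left]
    _ ≤ D * ∑' i, A * (‖f i‖ₑ * decayWeight α (n - i)) := by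
        refine mul_le_mul_right (ENNReal.tsum_le_tsum fun i => ?_) D
        rw [mul_left_comm]
        gcongr
        exact tsum_decayWeight_sub_mul_le hα hα1.le hαβ.le i n
    _ ≤ D * (A * C) := by
        rw [ENNReal.tsum_mul_left]
        gcongr
        exact h n

lemma MemLpZ.convBounded {p : ℝ} (hp : 1 < p) {a : ℤ → ℂ} (ha : MemLpZ p a) : ConvBounded a := by
  have hpq := Real.HolderConjugate.conjExponent hp
  set q := Real.conjExponent p
  have hq : 1 < q := hpq.symm.lt
  have hq0 : 0 < q := by linarith
  obtain ⟨α, hqα, hα1⟩ := exists_between (inv_lt_one_of_one_lt₀ hq)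
  have hα : 0 < α := (by positivity : 0 < q⁻¹).trans hqα
  have hαq : 1 < α * q := by rwa [inv_lt_iff_one_lt_mul₀ hq0] at hqα
  refine ⟨α, hα.le, hα1, ∑' j, ENNReal.ofReal (‖a j‖ ^ p) + ∑' j, decayWeight (α * q) j,
    ENNReal.add_ne_top.2 ⟨ha.tsum_ofReal_ne_top, tsum_decayWeight_ne_top hαq⟩, fun n => ?_⟩
  rw [← (Equiv.subLeft n).tsum_eq (decayWeight (α * q)), ← ENNReal.tsum_add]
  refine ENNReal.tsum_le_tsum fun j => ?_
  have hx := one_add_abs_pos (n - j)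
  set x : ℝ := 1 + |((n - j : ℤ) : ℝ)| with hxdef
  have h := Real.young_inequality_of_nonneg (norm_nonneg (a j))
    (Real.rpow_nonneg hx.le (-α)) hpq
  rw [← Real.rpow_mul hx.le] at h
  have h1 : ‖a j‖ ^ p / p ≤ ‖a j‖ ^ p := div_le_self (by positivity) hp.le
  have h2 : x ^ (-α * q) / q ≤ x ^ (-α * q) := div_le_self (by positivity) hq.le
  have h3 : ‖a j‖ * x ^ (-α) ≤ ‖a j‖ ^ p + x ^ (-(α * q)) := by
    rw [← neg_mul]; linarith
  simp only [Equiv.subLeft_apply, decayWeight]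
  rw [← hxdef, ← ofReal_norm, ← ENNReal.ofReal_mul (norm_nonneg _),
    ← ENNReal.ofReal_add (by positivity) (by positivity)]
  exact ENNReal.ofReal_le_ofReal h3

/-- The kernel `1 / m` restricted to odd integers. -/
def oddKernel (m : ℤ) : ℂ := {m : ℤ | Odd m}.indicator (fun m => (m : ℂ)⁻¹) m

/-- The kernel `1 / m` restricted to nonzero even integers. -/
def evenKernel (m : ℤ) : ℂ := {m : ℤ | Even m ∧ m ≠ 0}.indicator (fun m => (m : ℂ)⁻¹) m

lemma tsum_subtype_sub_mul {P : ℤ → Prop} (a k : ℤ → ℂ) (n : ℤ) :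
    ∑' m : {m : ℤ // P m}, a (n - (m : ℤ)) * k m =
      ∑' j, a j * {m : ℤ | P m}.indicator k (n - j) := by
  refine (tsum_subtype {m : ℤ | P m} fun m => a (n - m) * k m).trans ?_
  rw [← (Equiv.subLeft n).tsum_eq]
  refine tsum_congr fun j => ?_
  by_cases h : P (n - j) <;> simp [Set.indicator, h]

lemma KT_eq_tsum (a : ℤ → ℂ) (n : ℤ) :
    KT a n = (2 / (Real.pi : ℂ)) * ∑' j, a j * oddKernel (n - j) := by
  simp only [KT, oddKernel, div_eq_mul_inv _ ((_ : ℤ) : ℂ)]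
  rw [tsum_subtype_sub_mul a (fun m => (m : ℂ)⁻¹) n]

lemma HT_eq_tsum (a : ℤ → ℂ) (n : ℤ) :
    HT a n = (2 / (Real.pi : ℂ)) * ∑' j, a j * evenKernel (n - j) := by
  simp only [HT, evenKernel, div_eq_mul_inv _ ((_ : ℤ) : ℂ)]
  rw [tsum_subtype_sub_mul a (fun m => (m : ℂ)⁻¹) n]

lemma IT_eq_tsum (a : ℤ → ℂ) (n : ℤ) :
    IT a n = (4 / (Real.pi : ℂ) ^ 2) * ∑' j, a j * oddKernel (n - j) ^ 2 := by
  simp only [IT, div_eq_mul_inv _ (((_ : ℤ) : ℂ) ^ 2)]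
  rw [tsum_subtype_sub_mul a (fun m => ((m : ℂ) ^ 2)⁻¹) n]
  congr 1
  refine tsum_congr fun j => ?_
  by_cases h : Odd (n - j) <;> simp [oddKernel, Set.indicator, h]

lemma enorm_inv_le_decayWeight {m : ℤ} (hm : m ≠ 0) :
    ‖(m : ℂ)⁻¹‖ₑ ≤ 2 * decayWeight 1 m := by
  have h1 : (1 : ℝ) ≤ |(m : ℝ)| := by exact_mod_cast Int.one_le_abs hm
  have h : ‖(m : ℂ)⁻¹‖ ≤ 2 * (1 + |(m : ℝ)|) ^ (-(1 : ℝ)) := by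
    rw [norm_inv, Complex.norm_intCast, Real.rpow_neg_one, ← div_eq_mul_inv, inv_eq_one_div,
      div_le_div_iff₀ (by linarith) (by linarith)]
    linarith
  rw [← ofReal_norm]
  refine (ENNReal.ofReal_le_ofReal h).trans_eq ?_
  rw [ENNReal.ofReal_mul (by norm_num)]
  simp [decayWeight]

lemma enorm_oddKernel_le (m : ℤ) : ‖oddKernel m‖ₑ ≤ 2 * decayWeight 1 m := by
  by_cases h : Odd m
  · have hm : m ≠ 0 := by rintro rfl; simp at h
    simpa [oddKernel, Set.indicator, h] using enorm_inv_le_decayWeight hm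
  · simp [oddKernel, Set.indicator, h]

lemma enorm_evenKernel_le (m : ℤ) : ‖evenKernel m‖ₑ ≤ 2 * decayWeight 1 m := by
  by_cases h : Even m ∧ m ≠ 0
  · simpa [evenKernel, Set.indicator, h] using enorm_inv_le_decayWeight h.2
  · simp [evenKernel, Set.indicator, h]

lemma tsum_enorm_mul_evenKernel_le (f : ℤ → ℂ) (n : ℤ) :
    ∑' j, ‖f j * evenKernel (n - j)‖ₑ ≤ 2 * absConv f n := by
  rw [absConv, ← ENNReal.tsum_mul_left]
  refine ENNReal.tsum_le_tsum fun j => ?_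
  rw [enorm_mul, mul_left_comm]
  gcongr
  exact enorm_evenKernel_le _

lemma tsum_enorm_mul_oddKernel_le (f : ℤ → ℂ) (n : ℤ) :
    ∑' j, ‖f j * oddKernel (n - j)‖ₑ ≤ 2 * absConv f n := by
  rw [absConv, ← ENNReal.tsum_mul_left]
  refine ENNReal.tsum_le_tsum fun j => ?_
  rw [enorm_mul, mul_left_comm]
  gcongr
  exact enorm_oddKernel_le _

lemma ConvBounded.HT {f : ℤ → ℂ} (hf : ConvBounded f) : ConvBounded (HT f) := by
  refine hf.of_enorm_le_absConv (D := ‖(2 / (Real.pi : ℂ))‖ₑ * 2)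
    (ENNReal.mul_ne_top enorm_ne_top (by simp)) fun n => ?_
  rw [HT_eq_tsum, enorm_mul, mul_assoc]
  gcongr
  exact enorm_tsum_le_tsum_enorm.trans (tsum_enorm_mul_evenKernel_le f n)

lemma ConvBounded.summable_mul_oddKernel {f : ℤ → ℂ} (hf : ConvBounded f) (n : ℤ) :
    Summable fun j => f j * oddKernel (n - j) := by
  obtain ⟨C, hC, h⟩ := hf.absConv_le
  refine Summable.of_enorm (ne_top_of_le_ne_top (ENNReal.mul_ne_top (by simp) hC)
    ((tsum_enorm_mul_oddKernel_le f n).trans (mul_le_mul_right (h n) 2)))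

lemma oddKernel_mul_oddKernel {m l : ℤ} (h : m ≠ l) :
    oddKernel m * oddKernel l =
      oddKernel m * evenKernel (l - m) + oddKernel l * evenKernel (m - l) := by
  by_cases hm : Odd m
  · by_cases hl : Odd l
    · have h1 : m - l ≠ 0 := sub_ne_zero.2 h
      have h2 : l - m ≠ 0 := sub_ne_zero.2 h.symm
      have hm0 : (m : ℂ) ≠ 0 := by
        have : m ≠ 0 := by rintro rfl; simp at hm
        exact_mod_cast this
      have hl0 : (l : ℂ) ≠ 0 := by
        have : l ≠ 0 := by rintro rfl; simp at hl
        exact_mod_cast this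
      have h3 : (l : ℂ) - m ≠ 0 := by exact_mod_cast h2
      have h4 : (m : ℂ) - l = -(l - m) := by ring
      simp only [oddKernel, evenKernel, Set.indicator, Set.mem_ofPred_eq, hm, hl, hm.sub_odd hl,
        hl.sub_odd hm, h1, h2, ne_eq, not_false_eq_true, and_self, if_true]
      push_cast
      rw [h4]
      field_simp
      ring
    · have : ¬ Even (l - m) := by
        rw [Int.even_sub]; simp_all
      simp [oddKernel, evenKernel, Set.indicator, hl, this]
  · by_cases hl : Odd l
    · have : ¬ Even (m - l) := by
        rw [Int.even_sub]; simp_all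
      simp [oddKernel, evenKernel, Set.indicator, hm, this]
    · simp [oddKernel, Set.indicator, hm, hl]

lemma summable_prod_oddKernel_evenKernel {a b : ℤ → ℂ} (ha : ConvBounded a) (hb : ConvBounded b)
    (n : ℤ) :
    Summable fun x : ℤ × ℤ => a x.1 * oddKernel (n - x.1) * (b x.2 * evenKernel (x.1 - x.2)) := by
  obtain ⟨A, hA, hA'⟩ := ha.absConv_le
  obtain ⟨B, hB, hB'⟩ := hb.absConv_le
  refine Summable.of_enorm (ne_top_of_le_ne_top (b := 2 * A * (2 * B))
    (by finiteness) ?_)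
  rw [ENNReal.tsum_prod']
  simp_rw [enorm_mul (a _ * _), ENNReal.tsum_mul_left]
  calc ∑' i, ‖a i * oddKernel (n - i)‖ₑ * ∑' j, ‖b j * evenKernel (i - j)‖ₑ
      ≤ ∑' i, ‖a i * oddKernel (n - i)‖ₑ * (2 * B) := by
        gcongr with i
        exact (tsum_enorm_mul_evenKernel_le b i).trans (mul_le_mul_right (hB' i) 2)
    _ ≤ _ := by
        rw [ENNReal.tsum_mul_right]
        gcongr
        exact (tsum_enorm_mul_oddKernel_le a n).trans (mul_le_mul_right (hA' n) 2)

lemma tsum_prod_oddKernel_evenKernel {a b : ℤ → ℂ} (ha : ConvBounded a) (hb : ConvBounded b)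
    (n : ℤ) :
    (2 / (Real.pi : ℂ)) * (2 / (Real.pi : ℂ)) *
      ∑' x : ℤ × ℤ, a x.1 * oddKernel (n - x.1) * (b x.2 * evenKernel (x.1 - x.2)) =
      KT (fun m => a m * HT b m) n := by
  rw [(summable_prod_oddKernel_evenKernel ha hb n).tsum_prod, KT_eq_tsum, mul_assoc,
    ← tsum_mul_left]
  congr 1
  refine tsum_congr fun i => ?_
  dsimp only
  rw [tsum_mul_left, HT_eq_tsum]
  ring

lemma oddKernel_mul_oddKernel_sub (a b : ℤ → ℂ) (n i j : ℤ) :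
    a i * oddKernel (n - i) * (b j * oddKernel (n - j)) =
      a i * oddKernel (n - i) * (b j * evenKernel (i - j)) +
      b j * oddKernel (n - j) * (a i * evenKernel (j - i)) +
      if i = j then a i * b i * oddKernel (n - i) ^ 2 else 0 := by
  by_cases hij : i = j
  · subst hij
    simp only [evenKernel, Set.indicator, Set.mem_ofPred_eq, sub_self, ne_eq, not_true_eq_false,
      and_false, if_false, if_true]
    ring
  · have h := oddKernel_mul_oddKernel (m := n - i) (l := n - j) (by omega)
    rw [show n - j - (n - i) = i - j by ring, show n - i - (n - j) = j - i by ring] at h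
    rw [if_neg hij]
    linear_combination a i * b j * h

lemma tsum_mul_oddKernel_mul_tsum {a b : ℤ → ℂ} (ha : ConvBounded a) (hb : ConvBounded b)
    (n : ℤ) :
    (∑' i, a i * oddKernel (n - i)) * (∑' j, b j * oddKernel (n - j)) =
      ∑' x : ℤ × ℤ, a x.1 * oddKernel (n - x.1) * (b x.2 * evenKernel (x.1 - x.2)) +
      ∑' x : ℤ × ℤ, b x.1 * oddKernel (n - x.1) * (a x.2 * evenKernel (x.1 - x.2)) +
      ∑' j, a j * b j * oddKernel (n - j) ^ 2 := by
  have sa := (ha.summable_mul_oddKernel n).norm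
  have sb := (hb.summable_mul_oddKernel n).norm
  have sF := summable_mul_of_summable_norm sa sb
  have s₁ := summable_prod_oddKernel_evenKernel ha hb n
  have s₂ := (Equiv.prodComm ℤ ℤ).summable_iff.2 (summable_prod_oddKernel_evenKernel hb ha n)
  have t₂ := (Equiv.prodComm ℤ ℤ).tsum_eq fun x : ℤ × ℤ =>
    b x.1 * oddKernel (n - x.1) * (a x.2 * evenKernel (x.1 - x.2))
  simp only [Function.comp_def, Equiv.prodComm_apply, Prod.fst_swap, Prod.snd_swap] at s₂ t₂
  have s₃ : Summable fun x : ℤ × ℤ =>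
      if x.1 = x.2 then a x.1 * b x.1 * oddKernel (n - x.1) ^ 2 else 0 :=
    ((sF.sub s₁).sub s₂).congr fun x => by
      rw [oddKernel_mul_oddKernel_sub a b n x.1 x.2]
      ring
  rw [tsum_mul_tsum_of_summable_norm sa sb,
    tsum_congr fun x : ℤ × ℤ => oddKernel_mul_oddKernel_sub a b n x.1 x.2,
    (s₁.add s₂).tsum_add s₃, s₁.tsum_add s₂, t₂, s₃.tsum_prod]
  congr 1
  refine tsum_congr fun i => ?_
  rw [tsum_eq_single i fun j hj => if_neg hj.symm, if_pos rfl]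

/-- The product formula for the Kak–Hilbert transform. -/
lemma KT_mul_KT {a b : ℤ → ℂ} (ha : ConvBounded a) (hb : ConvBounded b) (n : ℤ) :
    KT a n * KT b n = KT (fun m => a m * HT b m) n + KT (fun m => b m * HT a m) n +
      IT (fun m => a m * b m) n := by
  rw [← tsum_prod_oddKernel_evenKernel ha hb, ← tsum_prod_oddKernel_evenKernel hb ha,
    IT_eq_tsum, KT_eq_tsum, KT_eq_tsum, mul_mul_mul_comm, tsum_mul_oddKernel_mul_tsum ha hb]
  ring

lemma Frame.build_set (a : ℤ → ℂ) (l : List Frame) :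
    Frame.build a (.set l) = HT (Frame.buildProd a (.set l)) := by
  rw [Frame.build]
  congr 1
  funext n
  simp [Frame.buildProd, List.attach_map_val (f := fun f => Frame.build a f n)]

lemma exists_eq_set_of_mem_skeletons {k : ℕ} {S : Frame} (hS : S ∈ skeletons k) :
    ∃ l, S = .set l := by
  match k with
  | 0 => simp [skeletons] at hS
  | 1 => exact ⟨_, by simpa [skeletons] using hS⟩
  | k + 2 =>
    simp only [skeletons, List.mem_append, List.mem_map] at hS
    rcases hS with ⟨T, -, rfl⟩ | ⟨T, -, rfl⟩
    · exact ⟨_, rfl⟩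
    · cases T <;> exact ⟨_, rfl⟩

lemma Frame.buildProd_pair_int (a : ℤ → ℂ) (l : List Frame) (i : ℤ) :
    Frame.buildProd a (.set [.set l, .int i]) =
      fun n => a n * HT (Frame.buildProd a (.set l)) n := by
  funext n
  rw [← Frame.build_set]
  simp [Frame.buildProd, Frame.build, mul_comm]

lemma Frame.buildProd_addElem (a : ℤ → ℂ) (l : List Frame) (i : ℤ) :
    Frame.buildProd a ((Frame.set l).addElem (.set [.int i])) =
      fun n => Frame.buildProd a (.set l) n * HT a n := by
  funext n
  simp [Frame.addElem, Frame.buildProd, Frame.build, mul_comm]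

lemma ConvBounded.buildProd {a : ℤ → ℂ} (ha : ConvBounded a) {k : ℕ} :
    ∀ {S : Frame}, S ∈ skeletons k → ConvBounded (Frame.buildProd a S) := by
  induction k with
  | zero => simp [skeletons]
  | succ k ih =>
    intro S hS
    cases k with
    | zero =>
      simp only [skeletons, List.mem_singleton] at hS
      subst hS
      simpa [Frame.buildProd, Frame.build] using ha
    | succ k =>
      simp only [skeletons, List.mem_append, List.mem_map] at hS
      rcases hS with ⟨T, hT, rfl⟩ | ⟨T, hT, rfl⟩ <;>
        obtain ⟨l, rfl⟩ := exists_eq_set_of_mem_skeletons hT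
      · rw [Frame.buildProd_pair_int]
        exact ha.mul (ih hT).HT
      · rw [Frame.buildProd_addElem]
        exact (ih hT).mul ha.HT

lemma KT_mul_sum_skeletons {a : ℤ → ℂ} (ha : ConvBounded a) (k : ℕ) (n : ℤ) :
    KT a n * ((skeletons (k + 1)).map fun S => KT (Frame.buildProd a S) n).sum =
      ((skeletons (k + 2)).map fun S => KT (Frame.buildProd a S) n).sum +
      ((skeletons (k + 1)).map fun S => IT (fun m => a m * Frame.buildProd a S m) n).sum := by
  simp only [skeletons, List.map_append, List.sum_append, List.map_map]
  rw [← List.sum_map_mul_left, ← List.sum_map_add, ← List.sum_map_add]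
  refine congrArg List.sum (List.map_congr_left fun S hS => ?_)
  obtain ⟨l, rfl⟩ := exists_eq_set_of_mem_skeletons hS
  simp only [Function.comp, Frame.buildProd_pair_int, Frame.buildProd_addElem]
  exact KT_mul_KT ha (ha.buildProd hS) n

/-- The skeletal decomposition of (𝓚a_n)^k. -/
theorem skeletal_decomposition (p : ℝ) (hp : 1 < p) (k : ℕ) (hk : 1 ≤ k)
    (a : ℤ → ℂ) (ha : MemLpZ p a) (n : ℤ) :
    (KT a n) ^ k =
      ((skeletons k).map (fun S => KT (Frame.buildProd a S) n)).sum +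
      ∑ j ∈ Finset.Icc 1 (k - 1),
        ((skeletons j).map (fun S => IT (fun m => a m * Frame.buildProd a S m) n)).sum *
          (KT a n) ^ (k - j - 1) := by
  have hac := ha.convBounded hp
  obtain ⟨k, rfl⟩ := Nat.exists_eq_add_of_le' hk
  clear hk
  induction k with
  | zero => simp [skeletons, Frame.buildProd, Frame.build]
  | succ k ih =>
    rw [pow_succ', ih, mul_add, KT_mul_sum_skeletons hac k n, add_assoc]
    congr 1
    rw [show k + 1 + 1 - 1 = k + 1 by omega, Finset.sum_Icc_succ_top (by omega), add_comm,
      Finset.mul_sum]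
    congr 1
    · refine Finset.sum_congr (by simp) fun j hj => ?_
      have hj' : j ≤ k := (Finset.mem_Icc.1 hj).2
      rw [show k + 1 + 1 - j - 1 = (k + 1 - j - 1) + 1 by omega, pow_succ]
      ring
    · simp

end
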